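/- Let d ≥ 1, 0 < q < p < ∞ and α < 2. Then LTS^p_α ⊂ 𝔇(𝔓_{α,p→q}), and the restriction of 𝔓_{α,p→q} to LTS^p_α is a bijection from LTS^p_α onto LTS^q_α. -/

import Mathlib

open MeasureTheory Set

noncomputable section

variable {E : Type*} [NormedAddCommGroup E] [NormedSpace ℝ E]
  [MeasurableSpace E] [BorelSpace E]

/-- The upsilon transform with dilation measure `ρ` on `(0,∞) ⊆ ℝ`:
`[Υ_ρ M](B) = ∫ M(s⁻¹ B) ρ(ds)`, realized as the image of `ρ ⊗ M` under `(s, x) ↦ s • x`. -/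
def Upsilon (ρ : Measure ℝ) (M : Measure E) : Measure E :=
  Measure.map (fun sx : ℝ × E => sx.1 • sx.2) (ρ.prod M)

/-- `M` is a Lévy measure: σ-finite, no mass at `0`, and `∫ (|x|² ∧ 1) M(dx) < ∞`. -/
def IsLevyMeasure (M : Measure E) : Prop :=
  SigmaFinite M ∧ M {0} = 0 ∧
    ∫⁻ x, ENNReal.ofReal (min (‖x‖ ^ 2) 1) ∂M < ⊤

/-- The domain `𝔇(Υ_ρ)`: Lévy measures `M` such that `Υ_ρ M` is again a Lévy measure. -/
def UpsilonDomain (ρ : Measure ℝ) : Set (Measure E) :=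
  {M | IsLevyMeasure M ∧ IsLevyMeasure (Upsilon ρ M)}

/-- The range `ℜ(Υ_ρ) = {Υ_ρ M : M ∈ 𝔇(Υ_ρ)}`. -/
def UpsilonRange (ρ : Measure ℝ) : Set (Measure E) :=
  Upsilon ρ '' UpsilonDomain (E := E) ρ

/-- The class `𝔐^α`: Borel measures with `M({0}) = 0` and `∫ (|x|² ∧ |x|^α) M(dx) < ∞`. -/
def MemMAlpha (α : ℝ) (M : Measure E) : Prop :=
  M {0} = 0 ∧ ∫⁻ x, ENNReal.ofReal (min (‖x‖ ^ 2) (‖x‖ ^ α)) ∂M < ⊤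

/-- The class `𝔐^log`: Lévy measures with `∫_{|x|>1} log|x| M(dx) < ∞`. -/
def MemMLog (M : Measure E) : Prop :=
  IsLevyMeasure M ∧
    ∫⁻ x in {x : E | 1 < ‖x‖}, ENNReal.ofReal (Real.log ‖x‖) ∂M < ⊤

/-- The dilation measure `ψ_{α,p}(ds) = s^{-α-1} e^{-s^p} 1_{s>0} ds`. -/
def psiMeasure (α p : ℝ) : Measure ℝ :=
  (volume : Measure ℝ).withDensity fun s =>
    if 0 < s then ENNReal.ofReal (s ^ (-α - 1) * Real.exp (-(s ^ p))) else 0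

/-- `K_{α,β,p} = ∫₀^∞ u^{α-β-1} e^{-u^p} du`. -/
def Kconst (α β p : ℝ) : ℝ :=
  ∫ u in Ioi (0 : ℝ), u ^ (α - β - 1) * Real.exp (-(u ^ p))

/-- The dilation measure
`τ_{β→α,p}(ds) = K_{α,β,p}⁻¹ s^{-α-1} (1-s^p)^{(α-β)/p - 1} 1_{0<s<1} ds`. -/
def tauMeasure (β α p : ℝ) : Measure ℝ :=
  (volume : Measure ℝ).withDensity fun s =>
    if 0 < s ∧ s < 1 then
      ENNReal.ofReal ((Kconst α β p)⁻¹ * (s ^ (-α - 1) * (1 - s ^ p) ^ ((α - β) / p - 1)))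
    else 0

/-- `f` is the density of the fully right-skewed `r`-stable distribution on `(0,∞)`:
a nonnegative measurable function with `∫₀^∞ e^{-t x} f(x) dx = e^{-t^r}` for all `t ≥ 0`. -/
def IsStableDensity (r : ℝ) (f : ℝ → ℝ) : Prop :=
  Measurable f ∧ (∀ x, 0 ≤ f x) ∧
    ∀ t : ℝ, 0 ≤ t →
      ∫ x in Ioi (0 : ℝ), Real.exp (-(t * x)) * f x = Real.exp (-(t ^ r))

/-- The dilation measure `π_{α,p→q}(ds) = p f_{q/p}(s^{-p}) s^{-α-p-1} 1_{s>0} ds`,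
where `f` is (to be assumed) the density of the fully right-skewed `q/p`-stable law. -/
def piMeasure (f : ℝ → ℝ) (α p : ℝ) : Measure ℝ :=
  (volume : Measure ℝ).withDensity fun s =>
    if 0 < s then ENNReal.ofReal (p * f (s ^ (-p)) * s ^ (-α - p - 1)) else 0

/-- The measure `ρ(ds) = g(s) 1_{s>0} ds`. -/
def densMeasure (g : ℝ → ℝ) : Measure ℝ :=
  (volume : Measure ℝ).withDensity fun s => if 0 < s then ENNReal.ofReal (g s) else 0

/-- The upsilon kernel of a measure with a density on `(0,∞)`, written as an integral. -/
theorem lintegral_densMeasure {g : ℝ → ℝ} (hg : Measurable g) {h : ℝ → ENNReal}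
    (hh : Measurable h) :
    ∫⁻ s, h s ∂(densMeasure g) = ∫⁻ s in Ioi 0, ENNReal.ofReal (g s) * h s := by
  have hm : Measurable fun s : ℝ => if 0 < s then ENNReal.ofReal (g s) else 0 :=
    Measurable.ite measurableSet_Ioi hg.ennreal_ofReal measurable_const
  rw [densMeasure, lintegral_withDensity_eq_lintegral_mul _ hm hh,
    ← lintegral_indicator measurableSet_Ioi]
  refine lintegral_congr fun s => ?_
  by_cases hs : 0 < s <;> simp [hs]

instance instSFiniteDensMeasure (g : ℝ → ℝ) : SFinite (densMeasure g) := by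
  unfold densMeasure; infer_instance

theorem densMeasure_singleton_zero (g : ℝ → ℝ) : densMeasure g {0} = 0 :=
  withDensity_absolutelyContinuous _ _ (by simp)

/-- The density of `ψ_{α,p}` on `(0,∞)`. -/
def psiDens (α p : ℝ) (s : ℝ) : ℝ := s ^ (-α - 1) * Real.exp (-(s ^ p))

/-- The density of `π_{α,p→q}` on `(0,∞)`. -/
def piDens (f : ℝ → ℝ) (α p : ℝ) (s : ℝ) : ℝ := p * f (s ^ (-p)) * s ^ (-α - p - 1)

theorem psiMeasure_eq (α p : ℝ) : psiMeasure α p = densMeasure (psiDens α p) := rfl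

theorem piMeasure_eq (f : ℝ → ℝ) (α p : ℝ) :
    piMeasure f α p = densMeasure (piDens f α p) := rfl

instance instSFinitePsiMeasure (α p : ℝ) : SFinite (psiMeasure α p) :=
  instSFiniteDensMeasure (psiDens α p)

instance instSFinitePiMeasure (f : ℝ → ℝ) (α p : ℝ) : SFinite (piMeasure f α p) :=
  instSFiniteDensMeasure (piDens f α p)

theorem measurable_psiDens (α p : ℝ) : Measurable (psiDens α p) := by
  unfold psiDens; fun_prop

theorem measurable_piDens {f : ℝ → ℝ} (hf : Measurable f) (α p : ℝ) :
    Measurable (piDens f α p) := by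
  unfold piDens; fun_prop

theorem lintegral_Upsilon [SecondCountableTopology E] (ρ : Measure ℝ) [SFinite ρ]
    (M : Measure E) [SFinite M] {g : E → ENNReal} (hg : Measurable g) :
    ∫⁻ x, g x ∂(Upsilon ρ M) = ∫⁻ x, ∫⁻ s, g (s • x) ∂ρ ∂M := by
  have hm : Measurable fun sx : ℝ × E => sx.1 • sx.2 := by fun_prop
  rw [Upsilon, lintegral_map hg hm]
  exact lintegral_prod_symm' _ (hg.comp hm)

instance instSFiniteUpsilon (ρ : Measure ℝ) [SFinite ρ] (M : Measure E) [SFinite M] :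
    SFinite (Upsilon ρ M) := by
  unfold Upsilon; infer_instance

theorem Upsilon_singleton_zero [SecondCountableTopology E] (g : ℝ → ℝ) (M : Measure E)
    [SFinite M] (hM : M {0} = 0) : Upsilon (densMeasure g) M {0} = 0 := by
  have hm : Measurable fun sx : ℝ × E => sx.1 • sx.2 := by fun_prop
  rw [Upsilon, Measure.map_apply hm (measurableSet_singleton _)]
  have hsub : (fun sx : ℝ × E => sx.1 • sx.2) ⁻¹' {0} ⊆
      ({0} : Set ℝ) ×ˢ (univ : Set E) ∪ (univ : Set ℝ) ×ˢ ({0} : Set E) := by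
    rintro ⟨s, x⟩ h
    simpa [smul_eq_zero] using h
  refine measure_mono_null hsub (measure_union_null ?_ ?_)
  · rw [Measure.prod_prod, densMeasure_singleton_zero, zero_mul]
  · rw [Measure.prod_prod, hM, mul_zero]

/-- Dilation of the integration variable on `(0,∞)`. -/
theorem setLIntegral_Ioi_comp_mul_left {s : ℝ} (hs : 0 < s) (h : ℝ → ENNReal) :
    ∫⁻ t in Ioi 0, ENNReal.ofReal s * h (s * t) = ∫⁻ u in Ioi 0, h u := by
  have himg : (fun t => s * t) '' Ioi (0 : ℝ) = Ioi 0 := by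
    rw [Set.image_mul_left_Ioi hs, mul_zero]
  have := lintegral_image_eq_lintegral_abs_deriv_mul (f := fun t => s * t) (f' := fun _ => s)
    (measurableSet_Ioi (a := (0 : ℝ)))
    (fun x _ => by simpa using ((hasDerivAt_id x).const_mul s).hasDerivWithinAt)
    ((mul_right_injective₀ hs.ne').injOn) h
  rw [himg, abs_of_pos hs] at this
  exact this.symm

theorem lintegral_stableDensity {r : ℝ} {f : ℝ → ℝ} (hf : IsStableDensity r f) {t : ℝ}
    (ht : 0 ≤ t) :
    ∫⁻ x in Ioi 0, ENNReal.ofReal (Real.exp (-(t * x)) * f x) =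
      ENNReal.ofReal (Real.exp (-(t ^ r))) := by
  obtain ⟨-, hf0, hL⟩ := hf
  rw [← hL t ht, ofReal_integral_eq_lintegral_ofReal]
  · by_contra hni
    have := hL t ht
    rw [integral_undef hni] at this
    exact (Real.exp_pos _).ne this
  · exact Filter.Eventually.of_forall fun x => mul_nonneg (Real.exp_pos _).le (hf0 x)

/-- The Laplace transform of the stable density after the substitution `x = s ^ (-p)`. -/
theorem lintegral_stableDensity_rpow {p q : ℝ} (hp : 0 < p) {f : ℝ → ℝ}
    (hf : IsStableDensity (q / p) f) {u : ℝ} (hu : 0 < u) :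
    ∫⁻ s in Ioi 0, ENNReal.ofReal
        (p * s ^ (-p - 1) * (Real.exp (-(u ^ p * s ^ (-p))) * f (s ^ (-p)))) =
      ENNReal.ofReal (Real.exp (-(u ^ q))) := by
  have himg : (fun s : ℝ => s ^ (-p)) '' Ioi (0 : ℝ) = Ioi 0 := by
    ext x
    constructor
    · rintro ⟨y, hy, rfl⟩
      exact Real.rpow_pos_of_pos hy _
    · intro hx
      refine ⟨x ^ (-p)⁻¹, Real.rpow_pos_of_pos hx _, ?_⟩
      exact Real.rpow_inv_rpow (le_of_lt hx) (by linarith)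
  have hinj : InjOn (fun s : ℝ => s ^ (-p)) (Ioi 0) := fun x hx y hy hxy =>
    (Real.rpow_left_inj (le_of_lt hx) (le_of_lt hy) (by linarith : -p ≠ 0)).1 hxy
  have key := lintegral_image_eq_lintegral_abs_deriv_mul (f := fun s : ℝ => s ^ (-p))
    (f' := fun s => -p * s ^ (-p - 1)) (measurableSet_Ioi (a := (0 : ℝ)))
    (fun x hx => (Real.hasDerivAt_rpow_const (Or.inl (ne_of_gt hx))).hasDerivWithinAt)
    hinj (fun x => ENNReal.ofReal (Real.exp (-(u ^ p * x)) * f x))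
  rw [himg, lintegral_stableDensity hf (Real.rpow_nonneg hu.le _), ← Real.rpow_mul hu.le,
    mul_div_cancel₀ _ hp.ne'] at key
  rw [key]
  refine setLIntegral_congr_fun measurableSet_Ioi fun s hs => ?_
  have h0 : (0 : ℝ) ≤ s ^ (-p - 1) := Real.rpow_nonneg (le_of_lt hs) _
  simp only [neg_mul, abs_neg, abs_of_nonneg (mul_nonneg hp.le h0)]
  rw [← ENNReal.ofReal_mul (mul_nonneg hp.le h0)]

/-- The multiplicative convolution of `π_{α,p→q}` and `ψ_{α,p}` is `ψ_{α,q}`. -/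
theorem lintegral_piMeasure_psiMeasure {α p q : ℝ} (hp : 0 < p) {f : ℝ → ℝ}
    (hf : IsStableDensity (q / p) f) {φ : ℝ → ENNReal} (hφ : Measurable φ) :
    ∫⁻ t, ∫⁻ s, φ (s * t) ∂(piMeasure f α p) ∂(psiMeasure α p) =
      ∫⁻ u, φ u ∂(psiMeasure α q) := by
  have hmπ := measurable_piDens hf.1 α p
  have hmψ := measurable_psiDens α p
  have hf0 := hf.2.1
  rw [lintegral_lintegral_swap (by fun_prop)]
  have hin : ∀ s : ℝ, ∫⁻ t, φ (s * t) ∂(psiMeasure α p) =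
      ∫⁻ t in Ioi 0, ENNReal.ofReal (psiDens α p t) * φ (s * t) := fun s => by
    rw [psiMeasure_eq, lintegral_densMeasure hmψ (by fun_prop)]
  simp_rw [hin]
  rw [piMeasure_eq, lintegral_densMeasure hmπ (by fun_prop), psiMeasure_eq,
    lintegral_densMeasure (measurable_psiDens α q) hφ]
  have hscale : ∀ s ∈ Ioi (0 : ℝ), ENNReal.ofReal (piDens f α p s) *
        ∫⁻ t in Ioi 0, ENNReal.ofReal (psiDens α p t) * φ (s * t) =
      ∫⁻ u in Ioi 0, ENNReal.ofReal (u ^ (-α - 1)) * φ u * ENNReal.ofReal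
        (p * s ^ (-p - 1) * (Real.exp (-(u ^ p * s ^ (-p))) * f (s ^ (-p)))) := by
    intro s hs
    rw [mem_Ioi] at hs
    rw [← lintegral_const_mul _ (by fun_prop)]
    refine Eq.trans ?_ (setLIntegral_Ioi_comp_mul_left hs _)
    refine setLIntegral_congr_fun measurableSet_Ioi fun t ht => ?_
    rw [mem_Ioi] at ht
    have hst : 0 < s * t := mul_pos hs ht
    have hπ0 : 0 ≤ piDens f α p s :=
      mul_nonneg (mul_nonneg hp.le (hf0 _)) (Real.rpow_nonneg hs.le _)
    have hreal : piDens f α p s * psiDens α p t = s * ((s * t) ^ (-α - 1) *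
        (p * s ^ (-p - 1) * (Real.exp (-((s * t) ^ p * s ^ (-p))) * f (s ^ (-p))))) := by
      have h1 : (s * t) ^ p * s ^ (-p) = t ^ p := by
        rw [Real.mul_rpow hs.le ht.le, mul_right_comm, ← Real.rpow_add hs]
        simp
      have h2 : s * (s ^ (-α - 1) * s ^ (-p - 1)) = s ^ (-α - p - 1) := by
        nth_rewrite 1 [← Real.rpow_one s]
        rw [← Real.rpow_add hs, ← Real.rpow_add hs]
        congr 1
        ring
      rw [h1, Real.mul_rpow hs.le ht.le, piDens, psiDens, ← h2]
      ring
    rw [← mul_assoc, ← ENNReal.ofReal_mul hπ0, hreal, ENNReal.ofReal_mul hs.le,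
      ENNReal.ofReal_mul (Real.rpow_nonneg hst.le _)]
    ring
  rw [setLIntegral_congr_fun measurableSet_Ioi hscale, lintegral_lintegral_swap]
  · refine setLIntegral_congr_fun measurableSet_Ioi fun u hu => ?_
    have hfm := hf.1
    rw [lintegral_const_mul _ (by fun_prop), lintegral_stableDensity_rpow hp hf hu, psiDens,
      ENNReal.ofReal_mul (Real.rpow_nonneg (le_of_lt hu) _)]
    ring
  · have hfm := hf.1
    fun_prop

/-- Composition rule `𝔓_{α,p→q} ∘ Ψ_{α,p} = Ψ_{α,q}`. -/
theorem Upsilon_piMeasure_Upsilon_psiMeasure [SecondCountableTopology E] {α p q : ℝ}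
    (hp : 0 < p) {f : ℝ → ℝ} (hf : IsStableDensity (q / p) f) (M : Measure E) [SFinite M] :
    Upsilon (piMeasure f α p) (Upsilon (psiMeasure α p) M) = Upsilon (psiMeasure α q) M := by
  refine Measure.ext_of_lintegral _ fun g hg => ?_
  rw [lintegral_Upsilon _ _ hg, lintegral_Upsilon _ _ (by fun_prop), lintegral_Upsilon _ _ hg]
  refine lintegral_congr fun x => ?_
  simp_rw [smul_smul]
  exact lintegral_piMeasure_psiMeasure hp hf (φ := fun u => g (u • x)) (by fun_prop)

theorem lintegral_rpow_mul_exp_neg_mul_rpow {p a b : ℝ} (hp : 0 < p) (ha : -1 < a)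
    (hb : 0 < b) :
    ∫⁻ x in Ioi (0 : ℝ), ENNReal.ofReal (x ^ a * Real.exp (-b * x ^ p)) =
      ENNReal.ofReal (b ^ (-(a + 1) / p) * (1 / p) * Real.Gamma ((a + 1) / p)) := by
  have hval := integral_rpow_mul_exp_neg_mul_rpow hp ha hb
  have hpos : 0 < b ^ (-(a + 1) / p) * (1 / p) * Real.Gamma ((a + 1) / p) := by
    have : 0 < Real.Gamma ((a + 1) / p) := Real.Gamma_pos_of_pos (div_pos (by linarith) hp)
    positivity
  rw [← hval, ofReal_integral_eq_lintegral_ofReal]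
  · by_contra hni
    rw [integral_undef hni] at hval
    exact hpos.ne hval
  · filter_upwards [ae_restrict_mem measurableSet_Ioi] with x hx
    exact mul_nonneg (Real.rpow_nonneg (le_of_lt hx) _) (Real.exp_pos _).le

omit [NormedSpace ℝ E] in
theorem isLevyMeasure_iff (M : Measure E) :
    IsLevyMeasure M ↔
      M {0} = 0 ∧ ∫⁻ x, ENNReal.ofReal (min (‖x‖ ^ 2) 1) ∂M < ⊤ := by
  refine ⟨fun h => h.2, fun h => ⟨?_, h⟩⟩
  obtain ⟨h0, hfin⟩ := h
  have hm : Measurable fun x : E => ENNReal.ofReal (min (‖x‖ ^ 2) 1) := by fun_prop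
  have hne : ∀ᵐ x ∂M, ENNReal.ofReal (min (‖x‖ ^ 2) 1) ≠ 0 := by
    have : ∀ᵐ x ∂M, x ≠ 0 := by simpa [ae_iff] using h0
    filter_upwards [this] with x hx
    have : 0 < ‖x‖ := norm_pos_iff.2 hx
    simp [hx]
  have hfm : IsFiniteMeasure (M.withDensity fun x => ENNReal.ofReal (min (‖x‖ ^ 2) 1)) :=
    isFiniteMeasure_withDensity hfin.ne
  rw [← withDensity_inv_same hm hne (by simp)]
  refine SigmaFinite.withDensity_of_ne_top ?_
  filter_upwards [(withDensity_absolutelyContinuous M _).ae_le hne] with x hx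
  simpa using hx

theorem min_sq_dilation_le {s r : ℝ} (hs : 1 ≤ s) :
    min ((s * r) ^ 2) 1 ≤ s ^ 2 * min (r ^ 2) 1 := by
  have h1 : 1 ≤ s ^ 2 := one_le_pow₀ hs
  rcases le_total (r ^ 2) 1 with h | h
  · rw [min_eq_left h]
    exact (min_le_left _ _).trans (by rw [mul_pow])
  · rw [min_eq_right h, mul_one]
    exact (min_le_right _ _).trans h1

theorem lintegral_min_sq_psiMeasure_le {α p q : ℝ} (hp : 0 < p) (hq : 0 < q) (hα : α < 2) :
    ∃ C : ENNReal, C ≠ ⊤ ∧ ∀ r : ℝ,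
      ∫⁻ s, ENNReal.ofReal (min ((s * r) ^ 2) 1) ∂(psiMeasure α q) ≤
        ENNReal.ofReal (Real.exp 1) *
          ∫⁻ s, ENNReal.ofReal (min ((s * r) ^ 2) 1) ∂(psiMeasure α p) +
        C * ENNReal.ofReal (min (r ^ 2) 1) := by
  have hm : ∀ r : ℝ, Measurable fun s : ℝ => ENNReal.ofReal (min ((s * r) ^ 2) 1) :=
    fun r => by fun_prop
  have hmp := measurable_psiDens α p
  refine ⟨∫⁻ s in Ioi (0 : ℝ), ENNReal.ofReal (s ^ (1 - α) * Real.exp (-1 * s ^ q)), ?_,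
    fun r => ?_⟩
  · rw [lintegral_rpow_mul_exp_neg_mul_rpow hq (by linarith) one_pos]
    exact ENNReal.ofReal_ne_top
  rw [psiMeasure_eq, psiMeasure_eq, lintegral_densMeasure (measurable_psiDens α q) (hm r),
    lintegral_densMeasure hmp (hm r), ← lintegral_const_mul _ (by fun_prop),
    ← lintegral_mul_const _ (by fun_prop), ← lintegral_add_left (by fun_prop)]
  refine setLIntegral_mono (by fun_prop) fun s hs => ?_
  rw [mem_Ioi] at hs
  have hn : 0 ≤ min ((s * r) ^ 2) 1 := by positivity
  have hexp : ∀ x : ℝ, 0 < Real.exp x := Real.exp_pos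
  have hψ : ∀ a, 0 ≤ psiDens α a s := fun a =>
    mul_nonneg (Real.rpow_nonneg hs.le _) (hexp _).le
  have hrp : ∀ a : ℝ, 0 ≤ s ^ a := fun a => Real.rpow_nonneg hs.le a
  rw [← ENNReal.ofReal_mul (hψ _), ← ENNReal.ofReal_mul (hψ _),
    ← ENNReal.ofReal_mul (hexp _).le, ← ENNReal.ofReal_mul (mul_nonneg (hrp _) (hexp _).le)]
  rcases le_total s 1 with h1 | h1
  · refine le_add_right (ENNReal.ofReal_le_ofReal ?_)
    rw [← mul_assoc]
    refine mul_le_mul_of_nonneg_right ?_ hn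
    rw [psiDens, psiDens, mul_left_comm, ← Real.exp_add]
    refine mul_le_mul_of_nonneg_left (Real.exp_le_exp.2 ?_) (hrp _)
    have := Real.rpow_le_one hs.le h1 hp.le
    linarith [hrp q]
  · refine le_add_left (ENNReal.ofReal_le_ofReal ?_)
    have h2 : s ^ (1 - α) = s ^ (-α - 1) * s ^ 2 := by
      rw [← Real.rpow_natCast s 2, ← Real.rpow_add hs]
      congr 1
      push_cast
      ring
    calc psiDens α q s * min ((s * r) ^ 2) 1
        ≤ psiDens α q s * (s ^ 2 * min (r ^ 2) 1) :=
          mul_le_mul_of_nonneg_left (min_sq_dilation_le h1) (hψ q)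
      _ = _ := by rw [psiDens, h2, neg_one_mul]; ring

/-- The domain of `Ψ_{α,p}` does not depend on `p`. -/
theorem UpsilonDomain_psiMeasure_subset [SecondCountableTopology E] {α p q : ℝ} (hp : 0 < p)
    (hq : 0 < q) (hα : α < 2) :
    UpsilonDomain (E := E) (psiMeasure α p) ⊆ UpsilonDomain (psiMeasure α q) := by
  rintro M ⟨hM, hΥ⟩
  refine ⟨hM, ?_⟩
  have hσ : SigmaFinite M := hM.1
  have hg : Measurable fun x : E => ENNReal.ofReal (min (‖x‖ ^ 2) 1) := by fun_prop
  have hΥfin := hΥ.2.2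
  obtain ⟨C, hC, hle⟩ := lintegral_min_sq_psiMeasure_le hp hq hα
  rw [isLevyMeasure_iff]
  refine ⟨Upsilon_singleton_zero _ M hM.2.1, ?_⟩
  rw [lintegral_Upsilon _ _ hg] at hΥfin ⊢
  have habs : ∀ (s : ℝ) (x : E), min (‖s • x‖ ^ 2) 1 = min ((s * ‖x‖) ^ 2) 1 := fun s x => by
    rw [norm_smul, mul_pow, mul_pow, Real.norm_eq_abs, sq_abs]
  simp_rw [habs] at hΥfin ⊢
  refine (lintegral_mono fun x : E => hle ‖x‖).trans_lt ?_
  rw [lintegral_add_right _ (by fun_prop), lintegral_const_mul _ (by fun_prop),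
    lintegral_const_mul _ (by fun_prop)]
  exact ENNReal.add_lt_top.2 ⟨ENNReal.mul_lt_top ENNReal.ofReal_lt_top hΥfin,
    ENNReal.mul_lt_top hC.lt_top hM.2.2⟩

/-- A finite measure on the unit interval is determined by its moments. -/
theorem unitInterval_measure_ext_of_moments {P P' : Measure unitInterval} [IsFiniteMeasure P]
    [IsFiniteMeasure P']
    (h : ∀ k : ℕ, ∫⁻ t, ENNReal.ofReal ((t : ℝ) ^ k) ∂P =
      ∫⁻ t, ENNReal.ofReal ((t : ℝ) ^ k) ∂P') : P = P' := by
  have hintegrable : ∀ (Q : Measure unitInterval) [IsFiniteMeasure Q] (g : C(unitInterval, ℝ)),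
      Integrable g Q := fun Q _ g =>
    (BoundedContinuousFunction.mkOfCompact g).integrable Q
  have hpow : ∀ k : ℕ, ∫ t, (t : ℝ) ^ k ∂P = ∫ t, (t : ℝ) ^ k ∂P' := fun k => by
    have hnn : ∀ t : unitInterval, 0 ≤ (t : ℝ) ^ k := fun t => pow_nonneg t.2.1 k
    rw [integral_eq_lintegral_of_nonneg_ae (.of_forall hnn) (by fun_prop),
      integral_eq_lintegral_of_nonneg_ae (.of_forall hnn) (by fun_prop), h k]
  have hcont : ∀ (Q : Measure unitInterval) [IsFiniteMeasure Q],
      Continuous fun g : C(unitInterval, ℝ) => ∫ t, g t ∂Q := fun Q _ => by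
    refine (continuous_integral.comp (ContinuousMap.toLp 1 Q ℝ).continuous).congr fun g => ?_
    exact integral_congr_ae (ContinuousMap.coeFn_toLp Q g)
  have hpoly : ∀ r : Polynomial ℝ, ∫ t : unitInterval, r.eval (t : ℝ) ∂P =
      ∫ t : unitInterval, r.eval (t : ℝ) ∂P' := fun r => by
    simp_rw [Polynomial.eval_eq_sum_range]
    rw [integral_finsetSum, integral_finsetSum]
    · simp_rw [integral_const_mul, hpow]
    · exact fun k _ => hintegrable P' ⟨fun t => r.coeff k * (t : ℝ) ^ k, by fun_prop⟩
    · exact fun k _ => hintegrable P ⟨fun t => r.coeff k * (t : ℝ) ^ k, by fun_prop⟩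
  have hall : ∀ g : C(unitInterval, ℝ), ∫ t, g t ∂P = ∫ t, g t ∂P' := by
    intro g
    have hg : g ∈ (polynomialFunctions unitInterval).topologicalClosure := by
      rw [polynomialFunctions_closure_eq_top']
      trivial
    have hclosed : IsClosed {g : C(unitInterval, ℝ) | ∫ t, g t ∂P = ∫ t, g t ∂P'} :=
      isClosed_eq (hcont P) (hcont P')
    refine closure_minimal ?_ hclosed hg
    intro g hg
    obtain ⟨r, -, rfl⟩ := hg
    exact hpoly r
  exact ext_of_forall_integral_eq_of_IsFiniteMeasure fun g => hall g.toContinuousMap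

/-- The direction `x / |x|` of a vector, with value `0` at `0`. -/
def direction (x : E) : E := ‖x‖⁻¹ • x

/-- The radial coordinate `|x|^q / (1 + |x|^q)`. -/
def radialCoord (q : ℝ) (x : E) : unitInterval :=
  ⟨‖x‖ ^ q / (1 + ‖x‖ ^ q), by
    have : 0 ≤ ‖x‖ ^ q := Real.rpow_nonneg (norm_nonneg x) q
    constructor
    · positivity
    · rw [div_le_one (by positivity)]
      linarith⟩

/-- The weight `|x|^α (|x|^q / (1 + |x|^q))^m`. -/
def radialWeight (α q : ℝ) (m : ℕ) (x : E) : ENNReal :=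
  ENNReal.ofReal (‖x‖ ^ α * (radialCoord q x : ℝ) ^ m)

theorem measurable_direction [SecondCountableTopology E] :
    Measurable (direction : E → E) := by
  unfold direction; fun_prop

omit [NormedSpace ℝ E] in
theorem measurable_radialCoord (q : ℝ) : Measurable (radialCoord q : E → unitInterval) := by
  refine Measurable.subtype_mk ?_
  fun_prop

omit [NormedSpace ℝ E] in
theorem measurable_radialWeight (α q : ℝ) (m : ℕ) :
    Measurable (radialWeight α q m : E → ENNReal) := by
  have := measurable_radialCoord (E := E) q
  unfold radialWeight
  fun_prop

omit [MeasurableSpace E] [BorelSpace E] in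
theorem direction_smul {s : ℝ} (hs : 0 < s) (x : E) : direction (s • x) = direction x := by
  rw [direction, direction, norm_smul, Real.norm_of_nonneg hs.le, smul_smul, mul_inv,
    mul_right_comm, inv_mul_cancel₀ hs.ne', one_mul]

omit [NormedSpace ℝ E] [MeasurableSpace E] [BorelSpace E] in
theorem radialWeight_ne_zero (α q : ℝ) (m : ℕ) {x : E} (hx : x ≠ 0) :
    radialWeight α q m x ≠ 0 := by
  have h0 : 0 < ‖x‖ := norm_pos_iff.2 hx
  have h1 : 0 < (radialCoord q x : ℝ) := by simp only [radialCoord]; positivity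
  have : 0 < ‖x‖ ^ α * (radialCoord q x : ℝ) ^ m := by positivity
  simpa [radialWeight] using this

omit [NormedSpace ℝ E] [MeasurableSpace E] [BorelSpace E] in
theorem radialWeight_add (α q : ℝ) (m k : ℕ) (x : E) :
    radialWeight α q (m + k) x =
      radialWeight α q m x * ENNReal.ofReal ((radialCoord q x : ℝ) ^ k) := by
  have h1 : 0 ≤ (radialCoord q x : ℝ) := (radialCoord q x).2.1
  rw [radialWeight, radialWeight, ← ENNReal.ofReal_mul (by positivity), pow_add, mul_assoc]

/-- Polar coordinates separate points, measurably. -/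
theorem exists_measurable_leftInverse_direction_radialCoord [SecondCountableTopology E] {q : ℝ}
    (hq : 0 < q) : ∃ ρ : E × unitInterval → E, Measurable ρ ∧
      ∀ x, ρ (direction x, radialCoord q x) = x := by
  refine ⟨fun z => ((z.2 : ℝ) / (1 - z.2)) ^ q⁻¹ • z.1, by fun_prop, fun x => ?_⟩
  have hr : 0 ≤ ‖x‖ ^ q := Real.rpow_nonneg (norm_nonneg x) q
  have h1 : (1 + ‖x‖ ^ q) ≠ 0 := by positivity
  have hfrac : ‖x‖ ^ q / (1 + ‖x‖ ^ q) / (1 - ‖x‖ ^ q / (1 + ‖x‖ ^ q)) = ‖x‖ ^ q := by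
    rw [one_sub_div h1, add_sub_cancel_right, div_div_div_cancel_right₀ h1, div_one]
  simp only [radialCoord, direction]
  rw [hfrac, Real.rpow_rpow_inv (norm_nonneg x) hq.ne', smul_smul]
  rcases eq_or_ne x 0 with rfl | hx
  · simp
  · rw [mul_inv_cancel₀ (norm_ne_zero_iff.2 hx), one_smul]

/-- Test function turning `Ψ_{α,q} M` into a weighted moment of `M` on a cone. -/
def coneTest (α q : ℝ) (m : ℕ) (S : Set E) : E → ENNReal :=
  (direction ⁻¹' S).indicator fun x =>
    ENNReal.ofReal (‖x‖ ^ (α + q * m) * Real.exp (-(‖x‖ ^ q)))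

theorem measurable_coneTest [SecondCountableTopology E] (α q : ℝ) (m : ℕ) {S : Set E}
    (hS : MeasurableSet S) : Measurable (coneTest α q m S) :=
  Measurable.indicator (by fun_prop) (measurable_direction hS)

theorem lintegral_coneTest_Upsilon [SecondCountableTopology E] {α q : ℝ} (hq : 0 < q) {m : ℕ}
    (hm : 0 < m) {S : Set E} (hS : MeasurableSet S) {M : Measure E} [SFinite M]
    (hM : M {0} = 0) :
    ∫⁻ x, coneTest α q m S x ∂(Upsilon (psiMeasure α q) M) =
      ENNReal.ofReal (1 / q * Real.Gamma m) *
        ∫⁻ x in direction ⁻¹' S, radialWeight α q m x ∂M := by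
  have hmeas := measurable_coneTest (E := E) α q m hS
  have hmr := measurable_radialWeight (E := E) α q m
  have hmS : MeasurableSet (direction ⁻¹' S) := measurable_direction hS
  have hmpos : (0 : ℝ) < m := by exact_mod_cast hm
  rw [lintegral_Upsilon _ _ hmeas, ← lintegral_indicator hmS,
    ← lintegral_const_mul _ (hmr.indicator hmS)]
  have hne : ∀ᵐ x ∂M, x ≠ 0 := by simpa [ae_iff] using hM
  refine lintegral_congr_ae ?_
  filter_upwards [hne] with x hx
  have hr : 0 < ‖x‖ := norm_pos_iff.2 hx
  rw [psiMeasure_eq, lintegral_densMeasure (measurable_psiDens α q) (by fun_prop)]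
  by_cases hxS : x ∈ direction ⁻¹' S
  swap
  · rw [indicator_of_notMem hxS, mul_zero, setLIntegral_congr_fun (g := fun _ => 0)
      measurableSet_Ioi, lintegral_zero]
    intro s hs
    have : s • x ∉ direction ⁻¹' S := by
      rwa [mem_preimage, direction_smul hs]
    simp [coneTest, this]
  rw [indicator_of_mem hxS]
  have hr1 : 0 < 1 + ‖x‖ ^ q := by positivity
  have hpt : ∀ s ∈ Ioi (0 : ℝ), ENNReal.ofReal (psiDens α q s) * coneTest α q m S (s • x) =
      ENNReal.ofReal (‖x‖ ^ (α + q * m)) *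
        ENNReal.ofReal (s ^ (q * m - 1) * Real.exp (-(1 + ‖x‖ ^ q) * s ^ q)) := by
    intro s hs
    rw [mem_Ioi] at hs
    have : s • x ∈ direction ⁻¹' S := by rwa [mem_preimage, direction_smul hs]
    rw [coneTest, indicator_of_mem this, ← ENNReal.ofReal_mul, ← ENNReal.ofReal_mul]
    · congr 1
      have e1 : s ^ (q * m - 1) = s ^ (-α - 1) * s ^ (α + q * m) := by
        rw [← Real.rpow_add hs]
        congr 1
        ring
      have e2 : Real.exp (-(1 + ‖x‖ ^ q) * s ^ q) =
          Real.exp (-(s ^ q)) * Real.exp (-(s ^ q * ‖x‖ ^ q)) := by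
        rw [← Real.exp_add]
        congr 1
        ring
      rw [psiDens, norm_smul, Real.norm_of_nonneg hs.le, Real.mul_rpow hs.le hr.le,
        Real.mul_rpow hs.le hr.le, e1, e2]
      ring
    · positivity
    · exact mul_nonneg (Real.rpow_nonneg hs.le _) (Real.exp_pos _).le
  have hqm : 0 < q * m := mul_pos hq hmpos
  rw [setLIntegral_congr_fun measurableSet_Ioi hpt, lintegral_const_mul _ (by fun_prop),
    lintegral_rpow_mul_exp_neg_mul_rpow hq (by linarith) hr1, radialWeight,
    ← ENNReal.ofReal_mul (by positivity), ← ENNReal.ofReal_mul]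
  · congr 1
    rw [sub_add_cancel, mul_div_cancel_left₀ _ hq.ne', neg_div, mul_div_cancel_left₀ _ hq.ne',
      Real.rpow_neg hr1.le, Real.rpow_natCast, Real.rpow_add hr, Real.rpow_mul hr.le,
      Real.rpow_natCast]
    simp only [radialCoord]
    rw [div_pow]
    ring
  · have := Real.Gamma_pos_of_pos hmpos
    positivity

theorem rpow_mul_exp_neg_rpow_le {q β : ℝ} (hq : 0 < q) (hβ : 2 ≤ β) :
    ∃ C : ℝ, 0 ≤ C ∧ ∀ r : ℝ, 0 ≤ r → r ^ β * Real.exp (-(r ^ q)) ≤ C * min (r ^ 2) 1 := by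
  refine ⟨(⌈β / q⌉₊.factorial : ℝ), by positivity, fun r hr => ?_⟩
  set n := ⌈β / q⌉₊
  have hn1 : (1 : ℝ) ≤ n.factorial := by exact_mod_cast n.factorial_pos
  rcases le_total r 1 with h | h
  · rw [min_eq_left (pow_le_one₀ hr h)]
    have h1 : r ^ β ≤ r ^ 2 := by
      rcases hr.eq_or_lt with rfl | hr'
      · rw [Real.zero_rpow (by linarith)]
        positivity
      · rw [← Real.rpow_natCast]
        exact Real.rpow_le_rpow_of_exponent_ge hr' h (by exact_mod_cast hβ)
    have h2 : Real.exp (-(r ^ q)) ≤ 1 := by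
      rw [Real.exp_le_one_iff]
      linarith [Real.rpow_nonneg hr q]
    calc r ^ β * Real.exp (-(r ^ q)) ≤ r ^ 2 * 1 := by gcongr
      _ = 1 * r ^ 2 := by ring
      _ ≤ n.factorial * r ^ 2 := by gcongr
  · rw [min_eq_right (one_le_pow₀ h), mul_one, Real.exp_neg, ← div_eq_mul_inv,
      div_le_iff₀ (Real.exp_pos _)]
    have h1 : r ^ β ≤ (r ^ q) ^ n := by
      rw [← Real.rpow_natCast, ← Real.rpow_mul hr]
      refine Real.rpow_le_rpow_of_exponent_le h ?_
      rw [mul_comm, ← div_le_iff₀ hq]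
      exact Nat.le_ceil _
    have h2 := Real.pow_div_factorial_le_exp (r ^ q) (Real.rpow_nonneg hr q) n
    rw [div_le_iff₀ (by positivity)] at h2
    linarith

theorem lintegral_coneTest_lt_top {α q : ℝ} (hq : 0 < q) {m : ℕ} (hm : 2 ≤ α + q * m)
    {N : Measure E} (hN : IsLevyMeasure N) (S : Set E) :
    ∫⁻ x, coneTest α q m S x ∂N < ⊤ := by
  obtain ⟨C, hC0, hC⟩ := rpow_mul_exp_neg_rpow_le hq hm
  refine lt_of_le_of_lt (lintegral_mono (g := fun x => ENNReal.ofReal C *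
    ENNReal.ofReal (min (‖x‖ ^ 2) 1)) fun x => ?_) ?_
  · refine (indicator_le_self _ _ x).trans ?_
    beta_reduce
    rw [← ENNReal.ofReal_mul hC0]
    exact ENNReal.ofReal_le_ofReal (hC ‖x‖ (norm_nonneg x))
  · rw [lintegral_const_mul _ (by fun_prop)]
    exact ENNReal.mul_lt_top ENNReal.ofReal_lt_top hN.2.2

/-- `Ψ_{α,q}` is injective on its domain. -/
theorem injOn_Upsilon_psiMeasure [SecondCountableTopology E] {α q : ℝ} (hq : 0 < q) :
    InjOn (Upsilon (E := E) (psiMeasure α q)) (UpsilonDomain (psiMeasure α q)) := by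
  rintro M ⟨⟨hσ, h0, -⟩, hΥ⟩ M' ⟨⟨hσ', h0', -⟩, hΥ'⟩ heq
  obtain ⟨m, hm⟩ := exists_nat_gt (max ((2 - α) / q) 0)
  have hm0 : 0 < m := by exact_mod_cast (le_max_right _ _).trans_lt hm
  have hm2 : 2 ≤ α + q * m := by
    have := (le_max_left _ _).trans_lt hm
    rw [div_lt_iff₀ hq] at this
    linarith
  have hmw := measurable_radialWeight (E := E) α q
  have hdir := measurable_direction (E := E)
  have hrad := measurable_radialCoord (E := E) q
  have hc : ∀ k : ℕ, 0 < k → ENNReal.ofReal (1 / q * Real.Gamma k) ≠ 0 := fun k hk => by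
    have : 0 < Real.Gamma k := Real.Gamma_pos_of_pos (by exact_mod_cast hk)
    have : 0 < 1 / q * Real.Gamma k := by positivity
    simpa using this
  have hfin : ∀ L : Measure E, SigmaFinite L → L {0} = 0 →
      IsLevyMeasure (Upsilon (psiMeasure α q) L) →
      IsFiniteMeasure (L.withDensity (radialWeight α q m)) := by
    intro L _ hL0 hL
    have h := lintegral_coneTest_lt_top hq hm2 hL univ
    rw [lintegral_coneTest_Upsilon hq hm0 .univ hL0, preimage_univ, Measure.restrict_univ] at h
    refine isFiniteMeasure_withDensity fun htop => ?_
    rw [htop, ENNReal.mul_top (hc m hm0)] at h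
    exact h.ne rfl
  have hP := hfin M hσ h0 hΥ
  have hP' := hfin M' hσ' h0' hΥ'
  have hcone : ∀ k : ℕ, 0 < k → ∀ S : Set E, MeasurableSet S →
      ∫⁻ x in direction ⁻¹' S, radialWeight α q k x ∂M =
        ∫⁻ x in direction ⁻¹' S, radialWeight α q k x ∂M' := by
    intro k hk S hS
    have h := congrArg (fun L => ∫⁻ x, coneTest α q k S x ∂L) heq
    simp only [lintegral_coneTest_Upsilon hq hk hS h0,
      lintegral_coneTest_Upsilon hq hk hS h0'] at h
    exact (ENNReal.mul_right_inj (hc k hk) ENNReal.ofReal_ne_top).1 h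
  have hmoment : ∀ (L : Measure E) (S : Set E) (_ : MeasurableSet S) (k : ℕ),
      ∫⁻ t, ENNReal.ofReal ((t : ℝ) ^ k) ∂(((L.withDensity (radialWeight α q m)).restrict
        (direction ⁻¹' S)).map (radialCoord q)) =
      ∫⁻ x in direction ⁻¹' S, radialWeight α q (m + k) x ∂L := by
    intro L S hS k
    rw [lintegral_map (by fun_prop) hrad, restrict_withDensity (hdir hS),
      lintegral_withDensity_eq_lintegral_mul _ (hmw m) (by fun_prop)]
    exact lintegral_congr fun x => (radialWeight_add α q m k x).symm
  have hmap : ∀ S : Set E, MeasurableSet S →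
      ((M.withDensity (radialWeight α q m)).restrict (direction ⁻¹' S)).map (radialCoord q) =
      ((M'.withDensity (radialWeight α q m)).restrict (direction ⁻¹' S)).map (radialCoord q) :=
    fun S hS => unitInterval_measure_ext_of_moments fun k => by
      rw [hmoment M S hS, hmoment M' S hS, hcone _ (by omega) S hS]
  have hpair : Measurable fun x : E => (direction x, radialCoord q x) := hdir.prodMk hrad
  have hprod : (M.withDensity (radialWeight α q m)).map
        (fun x => (direction x, radialCoord q x)) =
      (M'.withDensity (radialWeight α q m)).map (fun x => (direction x, radialCoord q x)) := by
    refine Measure.ext_prod fun {S T} hS hT => ?_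
    have h := congrArg (fun L => L T) (hmap S hS)
    simp only [Measure.map_apply hrad hT, Measure.restrict_apply (hrad hT)] at h
    rw [Measure.map_apply hpair (hS.prod hT), Measure.map_apply hpair (hS.prod hT),
      mk_preimage_prod, inter_comm, h]
  obtain ⟨ρ, hρ, hinv⟩ := exists_measurable_leftInverse_direction_radialCoord (E := E) hq
  have hdens : M.withDensity (radialWeight α q m) = M'.withDensity (radialWeight α q m) := by
    have h := congrArg (Measure.map ρ) hprod
    have hid : ρ ∘ (fun x : E => (direction x, radialCoord q x)) = id := funext hinv
    rwa [Measure.map_map hρ hpair, Measure.map_map hρ hpair, hid, Measure.map_id,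
      Measure.map_id] at h
  have hback : ∀ L : Measure E, L {0} = 0 → (L.withDensity (radialWeight α q m)).withDensity
      (fun x => (radialWeight α q m x)⁻¹) = L := by
    intro L hL0
    have hne : ∀ᵐ x ∂L, x ≠ 0 := by simpa [ae_iff] using hL0
    exact withDensity_inv_same (hmw m) (hne.mono fun x hx => radialWeight_ne_zero α q m hx)
      (.of_forall fun x => ENNReal.ofReal_ne_top)
  rw [← hback M h0, hdens, hback M' h0']

theorem stmt15 (d : ℕ) (hd : 1 ≤ d) (α q p : ℝ) (hq : 0 < q) (hqp : q < p) (hα : α < 2)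
    (f : ℝ → ℝ) (hf : IsStableDensity (q / p) f) :
    UpsilonRange (E := EuclideanSpace ℝ (Fin d)) (psiMeasure α p) ⊆
      UpsilonDomain (piMeasure f α p) ∧
    Set.BijOn (Upsilon (piMeasure f α p))
      (UpsilonRange (E := EuclideanSpace ℝ (Fin d)) (psiMeasure α p))
      (UpsilonRange (psiMeasure α q)) := by
  have hp : 0 < p := hq.trans hqp
  have hpq := UpsilonDomain_psiMeasure_subset (E := EuclideanSpace ℝ (Fin d)) hp hq hα
  have hqp' := UpsilonDomain_psiMeasure_subset (E := EuclideanSpace ℝ (Fin d)) hq hp hα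
  have hcomp : ∀ M ∈ UpsilonDomain (E := EuclideanSpace ℝ (Fin d)) (psiMeasure α p),
      Upsilon (piMeasure f α p) (Upsilon (psiMeasure α p) M) = Upsilon (psiMeasure α q) M :=
    fun M hM =>
      have : SigmaFinite M := hM.1.1
      Upsilon_piMeasure_Upsilon_psiMeasure hp hf M
  refine ⟨?_, ?_, ?_, ?_⟩
  · rintro _ ⟨M, hM, rfl⟩
    refine ⟨hM.2, ?_⟩
    rw [hcomp M hM]
    exact (hpq hM).2
  · rintro _ ⟨M, hM, rfl⟩
    exact ⟨M, hpq hM, (hcomp M hM).symm⟩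
  · rintro _ ⟨M, hM, rfl⟩ _ ⟨M', hM', rfl⟩ h
    rw [hcomp M hM, hcomp M' hM'] at h
    rw [injOn_Upsilon_psiMeasure hq (hpq hM) (hpq hM') h]
  · rintro _ ⟨M, hM, rfl⟩
    exact ⟨_, ⟨M, hqp' hM, rfl⟩, hcomp M (hqp' hM)⟩
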